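/- Let (X,d) be a compact metric space, f: X → X a homeomorphism with the entropy-dense property, and A: X → GL(m,ℝ) a continuous matrix function such that μ ↦ χ_max(A,μ) is lower semi-continuous on the f-invariant measures with the weak* topology. If there exist two ergodic f-invariant measures with different maximal Lyapunov exponents with respect to A, then sup{ h_μ(f) : μ ergodic, χ_max(A,μ) > inf_{ν invariant} χ_max(A,ν) } = h_top(f). -/

import Mathlib

open Filter MeasureTheory Set Topology Manifold
open scoped ENNReal NNReal

section EntropyDefs

variable {X : Type*} [MetricSpace X]

/-- The open dynamical (Bowen) ball `B_n(x,r) = {y | d_n(x,y) < r}`. -/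
def dynBall (f : X → X) (x : X) (n : ℕ) (r : ℝ) : Set X :=
  {y | ∀ i < n, dist (f^[i] x) (f^[i] y) < r}

/-- The closed dynamical (Bowen) ball `{y | d_n(x,y) ≤ r}`. -/
def dynCBall (f : X → X) (x : X) (n : ℕ) (r : ℝ) : Set X :=
  {y | ∀ i < n, dist (f^[i] x) (f^[i] y) ≤ r}

/-- `S` is an `(n,ε)`-separated subset of `E`. -/
def IsDynSep (f : X → X) (E : Set X) (n : ℕ) (ε : ℝ) (S : Set X) : Prop :=
  S ⊆ E ∧ ∀ x ∈ S, ∀ y ∈ S, x ≠ y → ∃ i < n, ε < dist (f^[i] x) (f^[i] y)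

/-- The maximal cardinality `s_n(E,ε)` of an `(n,ε)`-separated subset of `E`. -/
noncomputable def sepCount (f : X → X) (E : Set X) (n : ℕ) (ε : ℝ) : ℕ :=
  sSup {k | ∃ S : Finset X, IsDynSep f E n ε ↑S ∧ S.card = k}

/-- Bowen's separated-set topological entropy of a compact set:
`lim_{ε→0} limsup_n (1/n) log s_n(E,ε)`. -/
noncomputable def compactEnt (f : X → X) (E : Set X) : EReal :=
  ⨆ (ε : ℝ) (_ : 0 < ε),
    Filter.limsup (fun n : ℕ => ((Real.log (sepCount f E n ε) / n : ℝ) : EReal)) Filter.atTop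

/-- Topological entropy of an arbitrary subset `Y`: the supremum over compact `E ⊆ Y`. -/
noncomputable def topEnt (f : X → X) (Y : Set X) : EReal :=
  ⨆ (E : Set X) (_ : IsCompact E) (_ : E ⊆ Y), compactEnt f E

/-- The sum `Σ e^{-t·u}` over a family of Bowen balls recorded as center/order pairs. -/
noncomputable def bowenSum (t : ℝ) (s : Set (X × ℕ)) : ℝ≥0∞ :=
  ∑' p : s, ENNReal.ofReal (Real.exp (-t * ((p : X × ℕ).2 : ℝ)))

/-- `C(E;t,n,σ,f)`: infimum of `Σ e^{-t·u}` over countable covers of `E` by Bowen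
balls `B_u(x,σ)` with `u ≥ n`. -/
noncomputable def bowenCn (f : X → X) (E : Set X) (t : ℝ) (σ : ℝ) (n : ℕ) : ℝ≥0∞ :=
  ⨅ (s : Set (X × ℕ)) (_ : s.Countable) (_ : ∀ p ∈ s, n ≤ p.2)
    (_ : E ⊆ ⋃ p ∈ s, dynBall f p.1 p.2 σ), bowenSum t s

/-- `C(E;t,σ,f) = lim_{n→∞} C(E;t,n,σ,f)` (the limit of the nondecreasing sequence). -/
noncomputable def bowenC (f : X → X) (E : Set X) (t : ℝ) (σ : ℝ) : ℝ≥0∞ :=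
  ⨆ n : ℕ, bowenCn f E t σ n

/-- Bowen–Hausdorff entropy at scale `σ`: `inf {t | C(E;t,σ,f) = 0}`. -/
noncomputable def bowenEntAt (f : X → X) (E : Set X) (σ : ℝ) : EReal :=
  sInf {t : EReal | ∃ t' : ℝ, t = (t' : EReal) ∧ bowenC f E t' σ = 0}

/-- Bowen–Hausdorff entropy `h^B_top(f,E) = lim_{σ→0} h^B_top(E;σ,f)`. -/
noncomputable def bowenEnt (f : X → X) (E : Set X) : EReal :=
  ⨆ (σ : ℝ) (_ : 0 < σ), bowenEntAt f E σ

/-- Feng–Huang packing pre-measure `P^s_{N,ε}(E)`: supremum of `Σ e^{-s·n_i}` over countable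
pairwise disjoint families of closed Bowen balls of orders `n_i ≥ N` centered in `E`. -/
noncomputable def packPre (f : X → X) (s : ℝ) (N : ℕ) (ε : ℝ) (E : Set X) : ℝ≥0∞ :=
  ⨆ (D : Set (X × ℕ)) (_ : D.Countable) (_ : ∀ p ∈ D, p.1 ∈ E ∧ N ≤ p.2)
    (_ : D.Pairwise fun p q => Disjoint (dynCBall f p.1 p.2 ε) (dynCBall f q.1 q.2 ε)),
    ∑' p : D, ENNReal.ofReal (Real.exp (-s * ((p : X × ℕ).2 : ℝ)))

/-- `P^s_ε(E) = lim_{N→∞} P^s_{N,ε}(E)` (the limit of the nonincreasing sequence). -/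
noncomputable def packPreLim (f : X → X) (s ε : ℝ) (E : Set X) : ℝ≥0∞ :=
  ⨅ N : ℕ, packPre f s N ε E

/-- Feng–Huang packing measure `𝒫^s_ε(E) = inf {Σ_i P^s_ε(E_i) | E ⊆ ⋃ E_i}`. -/
noncomputable def packMeas (f : X → X) (s ε : ℝ) (E : Set X) : ℝ≥0∞ :=
  ⨅ (C : ℕ → Set X) (_ : E ⊆ ⋃ i, C i), ∑' i, packPreLim f s ε (C i)

/-- Packing topological entropy at scale `ε`: the critical exponent of `s ↦ 𝒫^s_ε(E)`. -/
noncomputable def packEntAt (f : X → X) (E : Set X) (ε : ℝ) : EReal :=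
  sInf {t : EReal | ∃ t' : ℝ, t = (t' : EReal) ∧ packMeas f t' ε E = 0}

/-- Packing topological entropy `h^P_top(f,E) = lim_{ε→0} h^P_top(f,E,ε)`. -/
noncomputable def packEnt (f : X → X) (E : Set X) : EReal :=
  ⨆ (ε : ℝ) (_ : 0 < ε), packEntAt f E ε

/-- The restriction of `f` to `Λ` is topologically mixing. -/
def TopMixingOn (f : X → X) (Λ : Set X) : Prop :=
  ∀ U V : Set X, IsOpen U → IsOpen V → (U ∩ Λ).Nonempty → (V ∩ Λ).Nonempty →
    ∃ N : ℕ, ∀ n ≥ N, (f^[n] '' (U ∩ Λ) ∩ (V ∩ Λ)).Nonempty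

end EntropyDefs

section MetricEntropy

variable {X : Type*} [MeasurableSpace X]

/-- Entropy `H_μ(⋁_{i=0}^{n-1} f^{-i} ξ)` of the `n`-th dynamical refinement of the finite
measurable partition `ξ = {P⁻¹(c)}_{c}`. -/
noncomputable def partHn (f : X → X) (μ : MeasureTheory.Measure X) {k : ℕ}
    (P : X → Fin k) (n : ℕ) : ℝ :=
  ∑ c : Fin n → Fin k,
    Real.negMulLog (μ {x | ∀ i : Fin n, P (f^[(i : ℕ)] x) = c i}).toReal

/-- Kolmogorov–Sinai metric entropy `h_μ(f)`: the supremum over finite measurable partitions of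
`lim_n (1/n) H_μ(⋁_{i<n} f^{-i} ξ) = inf_{n ≥ 1} (1/n) H_μ(⋁_{i<n} f^{-i} ξ)`. -/
noncomputable def ksEnt (f : X → X) (μ : MeasureTheory.Measure X) : EReal :=
  ⨆ (k : ℕ) (P : X → Fin k) (_ : Measurable P),
    (((⨅ n : ℕ, partHn f μ P (n + 1) / ((n : ℝ) + 1)) : ℝ) : EReal)

end MetricEntropy

section CocycleDefs

/-- Euclidean space `ℝ^m`. -/
abbrev Em (m : ℕ) := EuclideanSpace ℝ (Fin m)

variable {X : Type*} {m : ℕ}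

/-- The cocycle generated by the `GL(m,ℝ)`-valued function `A` over `f`:
`A(x,n) = A(f^{n-1}x) ⋯ A(f x) A(x)`. -/
noncomputable def cocycle (f : X → X) (A : X → (Em m ≃L[ℝ] Em m)) (x : X) :
    ℕ → (Em m →L[ℝ] Em m)
  | 0 => ContinuousLinearMap.id ℝ (Em m)
  | n + 1 => ((A (f^[n] x) : Em m →L[ℝ] Em m)).comp (cocycle f A x n)

/-- `A` is an `α`-Hölder continuous matrix function for some exponent `α > 0`
(in the operator norm). -/
def HolderMat [MetricSpace X] (A : X → (Em m ≃L[ℝ] Em m)) : Prop :=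
  ∃ α C : ℝ, 0 < α ∧ 0 ≤ C ∧ ∀ x y : X,
    ‖((A x : Em m →L[ℝ] Em m)) - ((A y : Em m →L[ℝ] Em m))‖ ≤ C * dist x y ^ α

/-- The set `MLI(A,f)` of Max-Lyapunov-irregular points: points where
`lim_n (1/n) log ‖A(x,n)‖` does not exist. -/
def MLIrr (f : X → X) (A : X → (Em m ≃L[ℝ] Em m)) : Set X :=
  {x | ¬ ∃ c : ℝ,
    Filter.Tendsto (fun n : ℕ => Real.log ‖cocycle f A x n‖ / n) Filter.atTop (nhds c)}

/-- The maximal Lyapunov exponent of an invariant measure: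
`χ_max(A,μ) = lim_n (1/n) ∫ log ‖A(x,n)‖ dμ = inf_{n ≥ 1} (1/n) ∫ log ‖A(x,n)‖ dμ`. -/
noncomputable def mle [MeasurableSpace X] (f : X → X) (A : X → (Em m ≃L[ℝ] Em m))
    (μ : MeasureTheory.Measure X) : ℝ :=
  ⨅ n : ℕ, (∫ x, Real.log ‖cocycle f A x (n + 1)‖ ∂μ) / ((n : ℝ) + 1)

/-- `μ` is a Lyapunov-minimizing (ergodic) measure for the cocycle `A`:
`χ_max(A,μ) = inf {χ_max(A,ν) : ν an f-invariant Borel probability measure}`. -/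
def IsLyapMin [MeasurableSpace X] (f : X → X) (A : X → (Em m ≃L[ℝ] Em m))
    (μ : MeasureTheory.Measure X) : Prop :=
  mle f A μ = sInf {r : ℝ | ∃ ν : MeasureTheory.Measure X,
    MeasureTheory.IsProbabilityMeasure ν ∧ MeasureTheory.MeasurePreserving f ν ν ∧
    r = mle f A ν}

end CocycleDefs

/-- `f` has the entropy-dense property: every invariant measure is a weak* limit of ergodic
measures with metric entropy approaching (from below) that of the given measure. -/
def EntropyDense {X : Type*} [MetricSpace X] [MeasurableSpace X] [OpensMeasurableSpace X]
    (f : X → X) : Prop :=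
  ∀ ν : ProbabilityMeasure X, MeasurePreserving f (ν : Measure X) (ν : Measure X) →
    ∀ G ∈ nhds ν, ∀ hstar : ℝ, (hstar : EReal) < ksEnt f (ν : Measure X) →
      ∃ μ : ProbabilityMeasure X, μ ∈ G ∧ Ergodic f (μ : Measure X) ∧
        (hstar : EReal) < ksEnt f (μ : Measure X)

section EntropyInequalities

/-- Gibbs' inequality. -/
theorem sum_negMulLog_le_sum_mul_neg_log {ι : Type*} [Fintype ι] {p q : ι → ℝ}
    (hp : ∀ i, 0 ≤ p i) (hp1 : ∑ i, p i = 1) (hq : ∀ i, 0 < q i) (hq1 : ∑ i, q i ≤ 1) :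
    ∑ i, Real.negMulLog (p i) ≤ ∑ i, p i * -Real.log (q i) := by
  have key : ∀ i, Real.negMulLog (p i) - p i * -Real.log (q i) ≤ q i - p i := by
    intro i
    rcases (hp i).eq_or_lt with h | h
    · simp [← h, (hq i).le]
    · have h1 := Real.log_le_sub_one_of_pos (div_pos (hq i) h)
      rw [Real.log_div (hq i).ne' h.ne'] at h1
      have h2 := mul_le_mul_of_nonneg_left h1 h.le
      have h3 : p i * (q i / p i - 1) = q i - p i := by field_simp
      rw [Real.negMulLog]
      linarith
  have := Finset.sum_le_sum fun i (_ : i ∈ Finset.univ) => key i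
  simp only [Finset.sum_sub_distrib] at this
  linarith

theorem integral_comp_fintype {X ι : Type*} [MeasurableSpace X] [Fintype ι] [MeasurableSpace ι]
    [MeasurableSingletonClass ι] (μ : Measure X) [IsFiniteMeasure μ] {Φ : X → ι}
    (hΦ : Measurable Φ) (g : ι → ℝ) :
    ∫ y, g (Φ y) ∂μ = ∑ c, μ.real (Φ ⁻¹' {c}) * g c := by
  rw [← integral_map hΦ.aemeasurable (measurable_of_finite g).aestronglyMeasurable,
    integral_fintype .of_finite]
  refine Finset.sum_congr rfl fun c _ => ?_
  rw [map_measureReal_apply hΦ (measurableSet_singleton c), smul_eq_mul]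

/-- The first `n` letters of the itinerary of `x` through the partition `P`. -/
def itinerary {X : Type*} (f : X → X) {k : ℕ} (P : X → Fin k) (n : ℕ) (x : X) : Fin n → Fin k :=
  fun i => P (f^[i] x)

variable {X : Type*} [MeasurableSpace X] {f : X → X} {k : ℕ} {P : X → Fin k}

theorem measurable_itinerary (hf : Measurable f) (hP : Measurable P) (n : ℕ) :
    Measurable (itinerary f P n) :=
  measurable_pi_lambda _ fun i => hP.comp (hf.iterate i)

theorem partHn_eq_sum_itinerary (f : X → X) (P : X → Fin k) (μ : Measure X) (n : ℕ) :
    partHn f μ P n = ∑ c, Real.negMulLog (μ.real (itinerary f P n ⁻¹' {c})) := by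
  refine Finset.sum_congr rfl fun c _ => ?_
  congr 3
  ext x
  simp [itinerary, funext_iff]

theorem sum_itinerary_measureReal (hf : Measurable f) (hP : Measurable P) (μ : Measure X)
    [IsProbabilityMeasure μ] (n : ℕ) : ∑ c, μ.real (itinerary f P n ⁻¹' {c}) = 1 := by
  simpa using (integral_comp_fintype μ (measurable_itinerary hf hP n) fun _ => 1).symm

theorem partHn_nonneg (μ : Measure X) [IsProbabilityMeasure μ] (n : ℕ) :
    0 ≤ partHn f μ P n :=
  Finset.sum_nonneg fun _ _ => Real.negMulLog_nonneg measureReal_nonneg measureReal_le_one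

theorem bddBelow_partHn_div (f : X → X) (μ : Measure X) [IsProbabilityMeasure μ]
    (P : X → Fin k) : BddBelow (range fun n : ℕ => partHn f μ P (n + 1) / ((n : ℝ) + 1)) :=
  ⟨0, by rintro _ ⟨n, rfl⟩; exact div_nonneg (partHn_nonneg μ _) (by positivity)⟩

theorem partHn_le_integral (hf : Measurable f) (hP : Measurable P) (μ : Measure X)
    [IsProbabilityMeasure μ] {n : ℕ} {q : (Fin n → Fin k) → ℝ} (hq : ∀ c, 0 < q c)
    (hq1 : ∑ c, q c ≤ 1) :
    partHn f μ P n ≤ ∫ y, -Real.log (q (itinerary f P n y)) ∂μ := by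
  rw [partHn_eq_sum_itinerary,
    integral_comp_fintype μ (measurable_itinerary hf hP n) fun c => -Real.log (q c)]
  exact sum_negMulLog_le_sum_mul_neg_log (fun _ => measureReal_nonneg)
    (sum_itinerary_measureReal hf hP μ n) hq hq1

/-- If every orbit segment of length `n` is shadowed, at all times it spends in `K`, by the
`Q`-itinerary of a point of `S`, then the entropy of the `n`-th refinement of `P` is at most
`log #S` up to an error controlled by the measure of the complement of `K`. -/
theorem partHn_le_log_card_add (hP : Measurable P) {μ : Measure X} [IsProbabilityMeasure μ]
    (hμ : MeasurePreserving f μ μ) {K : Set X} (hK : MeasurableSet K) (Q : X → Fin k)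
    {n : ℕ} {S : Finset X}
    (hS : ∀ y, ∃ x ∈ S, ∀ i < n, f^[i] y ∈ K → Q (f^[i] x) = P (f^[i] y))
    {t : ℝ} (ht : 0 < t) (ht1 : t ≤ 1) :
    partHn f μ P n ≤
      Real.log S.card + n * (Real.log (1 + t * k) + μ.real Kᶜ * -Real.log t) := by
  classical
  obtain ⟨x₀⟩ : Nonempty X := nonempty_of_isProbabilityMeasure μ
  have hSpos : 0 < (S.card : ℝ) := by
    obtain ⟨x, hx, -⟩ := hS x₀
    exact_mod_cast Finset.card_pos.2 ⟨x, hx⟩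
  have hD : 0 < 1 + t * k := by positivity
  let w : Fin k → Fin k → ℝ := fun a b => (if a = b then 1 else t) / (1 + t * k)
  have hw : ∀ a b, 0 < w a b := fun a b => by
    simp only [w]; split_ifs <;> positivity
  have hw1 : ∀ b, ∑ a, w a b ≤ 1 := fun b => by
    rw [← Finset.sum_div, div_le_one hD]
    calc ∑ a, (if a = b then 1 else t) ≤ ∑ a, ((if a = b then 1 else 0) + t) := by
          gcongr with a; split_ifs <;> linarith
      _ = 1 + t * k := by simp [Finset.sum_add_distrib, mul_comm]
  let q : (Fin n → Fin k) → ℝ := fun c =>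
    (S.card : ℝ)⁻¹ * ∑ x ∈ S, ∏ i : Fin n, w (c i) (Q (f^[i] x))
  have hprod : ∀ (c : Fin n → Fin k) (x : X), 0 < ∏ i : Fin n, w (c i) (Q (f^[i] x)) :=
    fun c x => Finset.prod_pos fun _ _ => hw _ _
  have hq : ∀ c, 0 < q c := fun c =>
    mul_pos (inv_pos.2 hSpos) (Finset.sum_pos (fun x _ => hprod c x)
      (Finset.card_pos.1 (by exact_mod_cast hSpos)))
  have hq1 : ∑ c, q c ≤ 1 := by
    rw [← Finset.mul_sum, Finset.sum_comm]
    have : ∑ x ∈ S, ∑ c : Fin n → Fin k, ∏ i : Fin n, w (c i) (Q (f^[i] x)) ≤ ∑ x ∈ S, 1 := by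
      refine Finset.sum_le_sum fun x _ => ?_
      have := Finset.prod_univ_sum (fun _ : Fin n => (Finset.univ : Finset (Fin k)))
        fun i a => w a (Q (f^[i] x))
      rw [Fintype.piFinset_univ] at this
      rw [← this]
      exact Finset.prod_le_one (fun i _ => Finset.sum_nonneg fun a _ => (hw _ _).le)
        fun i _ => hw1 _
    rw [inv_mul_le_iff₀ hSpos]
    simpa using this
  refine (partHn_le_integral hμ.measurable hP μ hq hq1).trans ?_
  have hpt : ∀ y, -Real.log (q (itinerary f P n y)) ≤ Real.log S.card +
      ∑ i : Fin n, (Real.log (1 + t * k) + (f^[i] ⁻¹' Kᶜ).indicator 1 y * -Real.log t) := by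
    intro y
    obtain ⟨x, hxS, hx⟩ := hS y
    have h1 : (S.card : ℝ)⁻¹ * ∏ i : Fin n, ((if f^[i] y ∈ K then 1 else t) / (1 + t * k))
        ≤ q (itinerary f P n y) := by
      refine mul_le_mul_of_nonneg_left (le_trans ?_ (Finset.single_le_sum
        (f := fun x => ∏ i : Fin n, w (itinerary f P n y i) (Q (f^[i] x)))
        (fun x _ => (hprod _ x).le) hxS)) (inv_pos.2 hSpos).le
      refine Finset.prod_le_prod (fun i _ => by split_ifs <;> positivity) fun i _ => ?_
      refine div_le_div_of_nonneg_right ?_ hD.le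
      by_cases hi : f^[i] y ∈ K
      · simp [itinerary, hx i i.2 hi, hi]
      · rw [if_neg hi]; split_ifs <;> linarith
    have hpos : ∀ i : Fin n, 0 < (if f^[i] y ∈ K then 1 else t) / (1 + t * k) := fun i => by
      split_ifs <;> positivity
    have h2 := Real.log_le_log (mul_pos (inv_pos.2 hSpos)
      (Finset.prod_pos fun i _ => hpos i)) h1
    rw [Real.log_mul (inv_pos.2 hSpos).ne' (Finset.prod_pos fun i _ => hpos i).ne',
      Real.log_inv, Real.log_prod fun i _ => (hpos i).ne'] at h2
    have h3 : ∑ i : Fin n, Real.log ((if f^[i] y ∈ K then 1 else t) / (1 + t * k)) =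
        -∑ i : Fin n, (Real.log (1 + t * k) + (f^[i] ⁻¹' Kᶜ).indicator 1 y * -Real.log t) := by
      rw [← Finset.sum_neg_distrib]
      refine Finset.sum_congr rfl fun i _ => ?_
      by_cases hi : f^[i] y ∈ K
      · simp [hi]
      · simp [hi, Real.log_div ht.ne' hD.ne', sub_eq_add_neg]
    linarith
  have hmeas : ∀ i, MeasurableSet (f^[i] ⁻¹' Kᶜ) := fun i => (hμ.measurable.iterate i) hK.compl
  have hind : ∀ i : Fin n, Integrable
      (fun y => (f^[i] ⁻¹' Kᶜ).indicator 1 y * -Real.log t) μ := fun i =>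
    ((integrable_const (1 : ℝ)).indicator (hmeas i)).mul_const _
  have hint : ∀ i : Fin n, Integrable
      (fun y => Real.log (1 + t * k) + (f^[i] ⁻¹' Kᶜ).indicator 1 y * -Real.log t) μ := fun i =>
    (integrable_const _).add (hind i)
  refine (integral_mono ?_ ((integrable_const _).add (integrable_finsetSum _ fun i _ => hint i))
    hpt).trans_eq ?_
  · exact (Integrable.of_finite (f := fun c => -Real.log (q c))).comp_measurable
      (μ := μ) (measurable_itinerary hμ.measurable hP n)
  · rw [integral_add' (integrable_const _) (integrable_finsetSum _ fun i _ => hint i),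
      integral_finsetSum _ fun i _ => hint i]
    have : ∀ i : Fin n, ∫ y, (Real.log (1 + t * k) +
        (f^[i] ⁻¹' Kᶜ).indicator 1 y * -Real.log t) ∂μ =
        Real.log (1 + t * k) + μ.real Kᶜ * -Real.log t := fun i => by
      rw [integral_add (integrable_const _) (hind i), integral_mul_const,
        integral_indicator_one (hmeas i),
        (hμ.iterate i).measureReal_preimage hK.compl.nullMeasurableSet]
      simp
    simp only [this]
    simp
    ring

end EntropyInequalities

section UpperBound

variable {X : Type*} [MetricSpace X] {f : X → X}

theorem isOpen_dynBall (hf : Continuous f) (x : X) (n : ℕ) (r : ℝ) : IsOpen (dynBall f x n r) := by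
  have : dynBall f x n r = ⋂ i ∈ Finset.range n, {y | dist (f^[i] x) (f^[i] y) < r} := by
    ext y; simp [dynBall]
  rw [this]
  exact isOpen_biInter_finset fun i _ =>
    isOpen_lt (continuous_const.dist (hf.iterate i)) continuous_const

variable [CompactSpace X]

theorem bddAbove_card_isDynSep (hf : Continuous f) (E : Set X) (n : ℕ) {ε : ℝ} (hε : 0 < ε) :
    BddAbove {k | ∃ S : Finset X, IsDynSep f E n ε ↑S ∧ S.card = k} := by
  obtain ⟨t, ht⟩ := isCompact_univ.elim_finite_subcover (fun x => dynBall f x n (ε / 2))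
    (fun x => isOpen_dynBall hf x n _)
    fun x _ => mem_iUnion.2 ⟨x, fun i _ => by simpa using half_pos hε⟩
  refine ⟨t.card, ?_⟩
  rintro k ⟨S, hS, rfl⟩
  have h : ∀ x, ∃ c ∈ t, x ∈ dynBall f c n (ε / 2) := fun x => by
    simpa using ht (mem_univ x)
  choose c hct hc using h
  refine Finset.card_le_card_of_injOn c (fun x _ => hct x) fun x hx y hy hxy => ?_
  by_contra hne
  obtain ⟨i, hi, hlt⟩ := hS.2 x hx y hy hne
  have h1 := hc x i hi
  have h2 := hc y i hi
  rw [← hxy] at h2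
  have h3 := dist_triangle_left (f^[i] x) (f^[i] y) (f^[i] (c x))
  linarith

theorem exists_finset_dynCBall_cover (hf : Continuous f) (n : ℕ) {ε : ℝ} (hε : 0 < ε) :
    ∃ S : Finset X, S.card = sepCount f univ n ε ∧ ∀ y, ∃ x ∈ S, y ∈ dynCBall f x n ε := by
  classical
  have hbdd := bddAbove_card_isDynSep hf univ n hε
  have hne : {k | ∃ S : Finset X, IsDynSep f univ n ε ↑S ∧ S.card = k}.Nonempty :=
    ⟨0, ∅, by simp [IsDynSep], rfl⟩
  obtain ⟨S, hS, hcard⟩ := Nat.sSup_mem hne hbdd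
  refine ⟨S, hcard, fun y => ?_⟩
  by_contra! hy
  have hyS : y ∉ S := fun h => hy y h fun i _ => by simpa using hε.le
  have hy' : ∀ x ∈ S, ∃ i < n, ε < dist (f^[i] x) (f^[i] y) := fun x hx => by
    simpa [dynCBall] using hy x hx
  have : IsDynSep f univ n ε ↑(insert y S) := by
    refine ⟨subset_univ _, fun a ha b hb hab => ?_⟩
    simp only [Finset.coe_insert, mem_insert_iff, Finset.mem_coe] at ha hb
    rcases ha with rfl | ha <;> rcases hb with rfl | hb
    · exact absurd rfl hab
    · simpa only [dist_comm] using hy' b hb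
    · exact hy' a ha
    · exact hS.2 a ha b hb hab
  have h := le_csSup hbdd ⟨insert y S, this, rfl⟩
  rw [Finset.card_insert_of_notMem hyS] at h
  lia

theorem limsup_sepCount_le_topEnt {ε : ℝ} (hε : 0 < ε) :
    limsup (fun n : ℕ => ((Real.log (sepCount f univ n ε) / n : ℝ) : EReal)) atTop ≤
      topEnt f univ :=
  (le_iSup₂ (f := fun (ε : ℝ) (_ : 0 < ε) => limsup (fun n : ℕ =>
      ((Real.log (sepCount f univ n ε) / n : ℝ) : EReal)) atTop) ε hε).trans
    (le_iSup_of_le univ (le_iSup₂_of_le isCompact_univ subset_rfl le_rfl))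

variable [MeasurableSpace X] [BorelSpace X]

/-- Goodwyn's theorem: metric entropy is bounded by topological entropy. -/
theorem ksEnt_le_topEnt (hf : Continuous f) {μ : Measure X} [IsProbabilityMeasure μ]
    (hμ : MeasurePreserving f μ μ) : ksEnt f μ ≤ topEnt f univ := by
  refine iSup_le fun k => iSup₂_le fun P hP => ?_
  set a : ℝ := ⨅ n : ℕ, partHn f μ P (n + 1) / ((n : ℝ) + 1)
  obtain ⟨x₀⟩ : Nonempty X := nonempty_of_isProbabilityMeasure μ
  suffices H : ∀ η : ℝ, 0 < η → ∃ ε : ℝ, 0 < ε ∧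
      ∀ n : ℕ, a - η ≤ Real.log (sepCount f univ (n + 1) ε) / ((n : ℝ) + 1) by
    refine le_of_forall_lt fun c hc => ?_
    obtain ⟨r, hcr, hra⟩ := EReal.lt_iff_exists_real_btwn.1 hc
    obtain ⟨ε, hε, h⟩ := H (a - r) (sub_pos.2 (EReal.coe_lt_coe_iff.1 hra))
    refine hcr.trans_le (le_trans ?_ (limsup_sepCount_le_topEnt hε))
    refine le_limsup_of_frequently_le (Eventually.frequently ?_)
    filter_upwards [eventually_ge_atTop 1] with n hn
    obtain ⟨n, rfl⟩ := Nat.exists_eq_add_of_le' hn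
    have := h n
    rw [sub_sub_cancel] at this
    exact_mod_cast this
  intro η hη
  obtain ⟨t, ht, ht1, htη⟩ : ∃ t : ℝ, 0 < t ∧ t ≤ 1 ∧ t * k ≤ η / 2 := by
    refine ⟨min 1 (η / (2 * (k + 1))), by positivity, min_le_left _ _, ?_⟩
    calc min 1 (η / (2 * (k + 1))) * k ≤ η / (2 * (k + 1)) * (k + 1) := by
          gcongr
          · exact min_le_right _ _
          · linarith
      _ = η / 2 := by field_simp
  have hlog : 0 ≤ -Real.log t := neg_nonneg.2 (Real.log_nonpos ht.le ht1)
  obtain ⟨δ, hδ, hδη⟩ : ∃ δ : ℝ, 0 < δ ∧ δ * -Real.log t ≤ η / 2 := by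
    refine ⟨η / 2 / (1 + -Real.log t), by positivity, ?_⟩
    rw [div_mul_eq_mul_div, div_le_iff₀ (by positivity)]
    nlinarith
  have hK : ∀ j : Fin k, ∃ K ⊆ P ⁻¹' {j}, IsClosed K ∧
      μ (P ⁻¹' {j} \ K) < ENNReal.ofReal (δ / (k + 1)) := fun j =>
    (hP (measurableSet_singleton j)).exists_isClosed_sdiff_lt (measure_ne_top μ _)
      (by simpa using (by positivity : 0 < δ / (k + 1)))
  choose K hKP hKcl hKμ using hK
  have hKmeas : MeasurableSet (⋃ j, K j) := .iUnion fun j => (hKcl j).measurableSet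
  have hKδ : μ.real (⋃ j, K j)ᶜ ≤ δ := by
    have hsub : (⋃ j, K j)ᶜ ⊆ ⋃ j, P ⁻¹' {j} \ K j := fun x hx => by
      simp only [mem_compl_iff, mem_iUnion, not_exists] at hx
      exact mem_iUnion.2 ⟨P x, rfl, hx _⟩
    calc μ.real (⋃ j, K j)ᶜ ≤ μ.real (⋃ j, P ⁻¹' {j} \ K j) := measureReal_mono hsub
      _ ≤ ∑ j, μ.real (P ⁻¹' {j} \ K j) := measureReal_iUnion_fintype_le _
      _ ≤ ∑ j : Fin k, δ / (k + 1) := by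
          gcongr with j
          exact ENNReal.toReal_le_of_le_ofReal (by positivity) (hKμ j).le
      _ ≤ δ := by
          simp only [Finset.sum_const, Finset.card_univ, Fintype.card_fin, nsmul_eq_mul]
          rw [mul_div_assoc', div_le_iff₀ (by positivity)]
          nlinarith
  obtain ⟨ρ, hρ, hdisj⟩ : ∃ ρ : ℝ, 0 < ρ ∧ ∀ i j, i ≠ j →
      Disjoint (Metric.thickening ρ (K i)) (Metric.thickening ρ (K j)) := by
    have : ∀ᶠ ρ : ℝ in 𝓝[>] 0, ∀ i j, i ≠ j →
        Disjoint (Metric.thickening ρ (K i)) (Metric.thickening ρ (K j)) := by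
      simp only [eventually_all]
      intro i j hij
      have hd : Disjoint (K i) (K j) := disjoint_left.2 fun x hi hj => by
        have h1 : P x = i := hKP i hi
        have h2 : P x = j := hKP j hj
        exact hij (h1.symm.trans h2)
      obtain ⟨ρ, hρ, h⟩ := hd.exists_thickenings (hKcl i).isCompact (hKcl j)
      filter_upwards [Ioo_mem_nhdsGT hρ] with r hr
      exact h.mono (Metric.thickening_mono hr.2.le _) (Metric.thickening_mono hr.2.le _)
    obtain ⟨ρ, h, hρ⟩ := (this.and self_mem_nhdsWithin).exists
    exact ⟨ρ, hρ, h⟩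
  obtain ⟨Q, hQ⟩ : ∃ Q : X → Fin k, ∀ x j, x ∈ Metric.thickening ρ (K j) → Q x = j := by
    classical
    refine ⟨fun x => if h : ∃ j, x ∈ Metric.thickening ρ (K j) then h.choose else P x₀,
      fun x j hx => ?_⟩
    have h : ∃ j, x ∈ Metric.thickening ρ (K j) := ⟨j, hx⟩
    by_contra hne
    simp only [h, dif_pos] at hne
    exact disjoint_left.1 (hdisj _ _ hne) h.choose_spec hx
  refine ⟨ρ / 2, half_pos hρ, fun n => ?_⟩
  obtain ⟨S, hcard, hS⟩ := exists_finset_dynCBall_cover hf (n + 1) (half_pos hρ)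
  have hH := partHn_le_log_card_add hP hμ hKmeas Q (n := n + 1) (S := S) (fun y => by
    obtain ⟨x, hxS, hx⟩ := hS y
    refine ⟨x, hxS, fun i hi hy => ?_⟩
    obtain ⟨j, hj⟩ := mem_iUnion.1 hy
    have hPj : P (f^[i] y) = j := hKP j hj
    rw [hPj]
    exact hQ _ _ (Metric.mem_thickening_iff.2 ⟨_, hj, (hx i hi).trans_lt (half_lt_self hρ)⟩))
    ht ht1
  have h1 : Real.log (1 + t * k) ≤ η / 2 := by
    have := Real.log_le_sub_one_of_pos (show 0 < 1 + t * k by positivity)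
    linarith
  have h2 : μ.real (⋃ j, K j)ᶜ * -Real.log t ≤ η / 2 :=
    (mul_le_mul_of_nonneg_right hKδ hlog).trans hδη
  have h3 : a ≤ partHn f μ P (n + 1) / ((n : ℝ) + 1) := ciInf_le (bddBelow_partHn_div f μ P) n
  have hn : (0 : ℝ) < n + 1 := by positivity
  rw [hcard] at hH
  push_cast at hH
  rw [sub_le_iff_le_add]
  refine h3.trans ?_
  rw [div_add' _ _ _ hn.ne']
  gcongr
  nlinarith

end UpperBound

section WordWeights

variable {α : Type*} [Fintype α]

/-- A nonnegative function of the first `n` letters of a sequence whose sum over all words of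
length `n` is at most one. -/
def IsWordWeight (n : ℕ) (w : (ℕ → α) → ℝ) : Prop :=
  ∃ v : (Fin n → α) → ℝ, (∀ c, 0 ≤ v c) ∧ ∑ c, v c ≤ 1 ∧ ∀ c : ℕ → α, w c = v fun i => c i

theorem IsWordWeight.mul {a b : ℕ} {w₁ w₂ : (ℕ → α) → ℝ} (h₁ : IsWordWeight a w₁)
    (h₂ : IsWordWeight b w₂) : IsWordWeight (a + b) fun c => w₁ c * w₂ fun i => c (a + i) := by
  obtain ⟨v₁, hv₁, hs₁, hw₁⟩ := h₁
  obtain ⟨v₂, hv₂, hs₂, hw₂⟩ := h₂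
  refine ⟨fun c => v₁ (fun i => c (Fin.castAdd b i)) * v₂ fun i => c (Fin.natAdd a i),
    fun c => mul_nonneg (hv₁ _) (hv₂ _), ?_, fun c => by simp [hw₁, hw₂]⟩
  rw [← (Fin.appendEquiv a b).sum_comp, Fintype.sum_prod_type]
  simp only [Fin.appendEquiv, Equiv.coe_fn_mk, Fin.append_left, Fin.append_right]
  rw [← Finset.sum_mul_sum]
  exact mul_le_one₀ hs₁ (Finset.sum_nonneg fun c _ => hv₂ c) hs₂

theorem isWordWeight_const (n : ℕ) :
    IsWordWeight n fun _ : ℕ → α => ((Fintype.card α : ℝ)⁻¹) ^ n := by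
  refine ⟨fun _ => ((Fintype.card α : ℝ)⁻¹) ^ n, fun _ => by positivity, ?_, fun _ => rfl⟩
  simp only [Finset.sum_const, Finset.card_univ, Fintype.card_fun, Fintype.card_fin, nsmul_eq_mul,
    Nat.cast_pow, ← mul_pow]
  exact pow_le_one₀ (by positivity) mul_inv_le_one

theorem isWordWeight_prod {q : ℕ} {p : (Fin q → α) → ℝ} (hp : ∀ c, 0 ≤ p c)
    (hp1 : ∑ c, p c ≤ 1) (m : ℕ) :
    IsWordWeight (q * m) fun c => ∏ l ∈ Finset.range m, p fun i => c (q * l + i) := by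
  induction m with
  | zero => simpa using isWordWeight_const (α := α) 0
  | succ m ih =>
    simp only [Finset.prod_range_succ]
    exact ih.mul (w₂ := fun c => p fun i => c i) ⟨p, hp, hp1, fun _ => rfl⟩

/-- A finite family of sequences with distinct initial words has logarithmic cardinality at most
its average code length with respect to any word weight. -/
theorem IsWordWeight.card_mul_log_card_le {n : ℕ} {w : (ℕ → α) → ℝ} (hw : IsWordWeight n w)
    {ι : Type*} {S : Finset ι} {s : ι → ℕ → α}
    (hs : ∀ x ∈ S, ∀ y ∈ S, x ≠ y → ∃ i < n, s x i ≠ s y i) (hpos : ∀ x ∈ S, 0 < w (s x)) :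
    S.card * Real.log S.card ≤ ∑ x ∈ S, -Real.log (w (s x)) := by
  classical
  obtain ⟨v, hv, hv1, hwv⟩ := hw
  rcases S.eq_empty_or_nonempty with rfl | hne
  · simp
  have hcard : 0 < (S.card : ℝ) := by exact_mod_cast hne.card_pos
  have hsum : ∑ x ∈ S, w (s x) ≤ 1 := by
    simp only [hwv]
    rw [← Finset.sum_image (f := v) (s := S) (g := fun x (i : Fin n) => s x i)]
    · exact (Finset.sum_le_univ_sum_of_nonneg hv).trans hv1
    · intro x hx y hy hxy
      by_contra hne
      obtain ⟨i, hi, h⟩ := hs x hx y hy hne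
      exact h (congrFun hxy ⟨i, hi⟩)
  have key : ∀ x ∈ S, Real.log S.card - -Real.log (w (s x)) ≤ S.card * w (s x) - 1 := by
    intro x hx
    have := Real.log_le_sub_one_of_pos (mul_pos hcard (hpos x hx))
    rw [Real.log_mul hcard.ne' (hpos x hx).ne'] at this
    linarith
  have := Finset.sum_le_sum key
  simp only [Finset.sum_sub_distrib, ← Finset.mul_sum, Finset.sum_const, nsmul_eq_mul] at this
  nlinarith

theorem sum_range_mul_eq_sum_sum (g : ℕ → ℝ) (q m : ℕ) :
    ∑ i ∈ Finset.range (q * m), g i =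
      ∑ j ∈ Finset.range q, ∑ l ∈ Finset.range m, g (j + q * l) := by
  rw [Finset.sum_comm]
  induction m with
  | zero => simp
  | succ m ih =>
    rw [Nat.mul_succ, Finset.sum_range_add, ih, Finset.sum_range_succ]
    simp only [add_comm]

/-- Comparison of the number of distinct words of length `n` with the average code length of
subwords of length `q`. -/
theorem card_mul_log_card_le_sum_blocks {q n : ℕ} (hq : 0 < q) (hqn : q ≤ n)
    {p : (Fin q → α) → ℝ} (hp : ∀ c, 0 ≤ p c) (hp1 : ∑ c, p c ≤ 1) {ι : Type*} {S : Finset ι}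
    {s : ι → ℕ → α} (hs : ∀ x ∈ S, ∀ y ∈ S, x ≠ y → ∃ i < n, s x i ≠ s y i)
    (hpos : ∀ x ∈ S, ∀ i < n, 0 < p fun t => s x (i + t)) :
    q * (S.card * Real.log S.card) ≤ q * (S.card * (2 * q * Real.log (Fintype.card α))) +
      ∑ x ∈ S, ∑ i ∈ Finset.range n, -Real.log (p fun t => s x (i + t)) := by
  rcases S.eq_empty_or_nonempty with rfl | ⟨x₀, hx₀⟩
  · simp
  have : Nonempty α := ⟨s x₀ 0⟩
  have hk : 0 < (Fintype.card α : ℝ) := by exact_mod_cast Fintype.card_pos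
  have hk1 : (1 : ℝ) ≤ Fintype.card α := by exact_mod_cast Fintype.card_pos
  obtain ⟨m, hm⟩ : ∃ m, n / q = m + 1 :=
    Nat.exists_eq_add_of_le' ((Nat.one_le_div_iff hq).2 hqn)
  have hdiv := Nat.div_add_mod n q
  have hmod := Nat.mod_lt n hq
  rw [hm, Nat.mul_succ] at hdiv
  have hp_le : ∀ c, p c ≤ 1 := fun c =>
    (Finset.single_le_sum (fun c _ => hp c) (Finset.mem_univ c)).trans hp1
  have hblock : ∀ j < q, ∀ l < m, j + q * l < n := fun j hj l hl => by
    have : q * l ≤ q * m := Nat.mul_le_mul_left q hl.le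
    lia
  have step : ∀ j ∈ Finset.range q, S.card * Real.log S.card ≤
      S.card * (2 * q * Real.log (Fintype.card α)) +
      ∑ x ∈ S, ∑ l ∈ Finset.range m, -Real.log (p fun t => s x (j + q * l + t)) := by
    intro j hj
    rw [Finset.mem_range] at hj
    obtain ⟨r, hr⟩ : ∃ r, j + (q * m + r) = n := ⟨n - j - q * m, by lia⟩
    have hw := (isWordWeight_const (α := α) j).mul
      ((isWordWeight_prod hp hp1 m).mul (isWordWeight_const r))
    rw [hr] at hw
    have hppos : ∀ x ∈ S, ∀ l ∈ Finset.range m,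
        0 < p fun t => s x (j + (q * l + t)) := fun x hx l hl => by
      simpa only [add_assoc] using hpos x hx _ (hblock j hj l (Finset.mem_range.1 hl))
    refine (hw.card_mul_log_card_le hs fun x hx => ?_).trans ?_
    · have := Finset.prod_pos (hppos x hx)
      positivity
    · rw [← nsmul_eq_mul, ← Finset.sum_const, ← Finset.sum_add_distrib]
      refine Finset.sum_le_sum fun x hx => ?_
      have hprod := Finset.prod_pos (hppos x hx)
      rw [Real.log_mul (by positivity) (by positivity), Real.log_mul hprod.ne' (by positivity),
        Real.log_prod fun l hl => (hppos x hx l hl).ne', Real.log_pow, Real.log_pow, Real.log_inv]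
      simp only [add_assoc, Finset.sum_neg_distrib]
      have hjr : ((j : ℝ) + r) ≤ 2 * q := by
        have : j + r ≤ 2 * q := by lia
        exact_mod_cast this
      have := mul_le_mul_of_nonneg_right hjr (Real.log_nonneg hk1)
      linarith
  have := Finset.sum_le_sum step
  simp only [Finset.sum_add_distrib, Finset.sum_const, Finset.card_range, nsmul_eq_mul] at this
  refine this.trans (add_le_add_right ?_ _)
  rw [Finset.sum_comm]
  refine Finset.sum_le_sum fun x _ => ?_
  rw [← sum_range_mul_eq_sum_sum (fun i => -Real.log (p fun t => s x (i + t)))]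
  refine Finset.sum_le_sum_of_subset_of_nonneg (Finset.range_mono (by lia)) fun i _ _ => ?_
  exact neg_nonneg.2 (Real.log_nonpos (hp _) (hp_le _))

end WordWeights

section OrbitMeasure

variable {X : Type*} [MeasurableSpace X]

/-- The average of the Dirac masses along the orbit segments of length `n` starting in `S`. -/
noncomputable def orbitMeasure (f : X → X) (S : Finset X) (n : ℕ) : Measure X :=
  ((n : ℝ≥0∞) * S.card)⁻¹ • ∑ x ∈ S, ∑ i ∈ Finset.range n, Measure.dirac (f^[i] x)

theorem isProbabilityMeasure_orbitMeasure (f : X → X) {S : Finset X} (hS : S.Nonempty) {n : ℕ}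
    (hn : 0 < n) : IsProbabilityMeasure (orbitMeasure f S n) := by
  constructor
  have h1 : (n : ℝ≥0∞) * S.card ≠ 0 := by
    simp [hn.ne', hS.ne_empty]
  have h2 : (n : ℝ≥0∞) * S.card ≠ ∞ := ENNReal.mul_ne_top (by simp) (by simp)
  simp only [orbitMeasure, Measure.smul_apply, Measure.coe_finsetSum, Finset.sum_apply,
    measure_univ, Finset.sum_const, Finset.card_range, nsmul_eq_mul, mul_one, smul_eq_mul]
  rw [mul_comm (S.card : ℝ≥0∞), ENNReal.inv_mul_cancel h1 h2]

variable [MeasurableSingletonClass X]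

theorem integral_orbitMeasure (f : X → X) (S : Finset X) (n : ℕ) (g : X → ℝ) :
    ∫ y, g y ∂(orbitMeasure f S n) =
      ((n : ℝ) * S.card)⁻¹ * ∑ x ∈ S, ∑ i ∈ Finset.range n, g (f^[i] x) := by
  have hint : ∀ x, Integrable g (Measure.dirac x) := fun x => integrable_dirac (by simp)
  rw [orbitMeasure, integral_smul_measure, integral_finsetSum_measure fun x _ =>
    integrable_finsetSum_measure.2 fun i _ => hint _]
  simp only [integral_finsetSum_measure fun i _ => hint _, integral_dirac]
  simp

theorem orbitMeasure_real_pos {f : X → X} {S : Finset X} {n : ℕ} {x : X} (hx : x ∈ S) {i : ℕ}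
    (hi : i < n) {C : Set X} (hC : f^[i] x ∈ C) (hCm : MeasurableSet C) :
    0 < (orbitMeasure f S n).real C := by
  have hS : 0 < (S.card : ℝ) := by exact_mod_cast Finset.card_pos.2 ⟨x, hx⟩
  have hn : 0 < (n : ℝ) := by exact_mod_cast (Nat.zero_le i).trans_lt hi
  have hnn : ∀ y, 0 ≤ C.indicator (1 : X → ℝ) y := fun y => indicator_nonneg (fun _ _ => by simp) y
  rw [← integral_indicator_one hCm, integral_orbitMeasure]
  refine mul_pos (by positivity) (Finset.sum_pos' (fun x _ => Finset.sum_nonneg fun i _ => hnn _)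
    ⟨x, hx, Finset.sum_pos' (fun i _ => hnn _) ⟨i, Finset.mem_range.2 hi, by simp [hC]⟩⟩)

theorem mul_log_card_le_partHn_orbitMeasure {f : X → X} (hf : Measurable f) {k : ℕ}
    {P : X → Fin k} (hP : Measurable P) {S : Finset X} (hSne : S.Nonempty) {q n : ℕ} (hq : 0 < q)
    (hqn : q ≤ n)
    (hS : ∀ x ∈ S, ∀ y ∈ S, x ≠ y → ∃ i < n, P (f^[i] x) ≠ P (f^[i] y)) :
    q * Real.log S.card ≤ 2 * q ^ 2 * Real.log k + n * partHn f (orbitMeasure f S n) P q := by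
  have hn : 0 < n := hq.trans_le hqn
  have := isProbabilityMeasure_orbitMeasure f hSne hn
  set μ := orbitMeasure f S n with hμ
  have hc : 0 < (S.card : ℝ) := by exact_mod_cast hSne.card_pos
  have hn' : 0 < (n : ℝ) := by exact_mod_cast hn
  have hit := measurable_itinerary hf hP q
  have hword : ∀ x i, (fun t : Fin q => P (f^[i + t] x)) = itinerary f P q (f^[i] x) :=
    fun x i => funext fun t => by rw [itinerary, ← Function.iterate_add_apply, add_comm]
  have h := card_mul_log_card_le_sum_blocks hq hqn
    (p := fun c => μ.real (itinerary f P q ⁻¹' {c})) (fun _ => measureReal_nonneg)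
    (sum_itinerary_measureReal hf hP μ q).le (s := fun x i => P (f^[i] x)) hS
    fun x hx i hi => orbitMeasure_real_pos hx hi
      (hword x i).symm (hit (measurableSet_singleton _))
  have hH : partHn f μ P q = ((n : ℝ) * S.card)⁻¹ * ∑ x ∈ S, ∑ i ∈ Finset.range n,
      -Real.log (μ.real (itinerary f P q ⁻¹' {fun t : Fin q => P (f^[i + t] x)})) := by
    simp only [hword]
    rw [← integral_orbitMeasure f S n fun y =>
      -Real.log (μ.real (itinerary f P q ⁻¹' {itinerary f P q y})), ← hμ,
      integral_comp_fintype μ hit fun c => -Real.log (μ.real (itinerary f P q ⁻¹' {c})),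
      partHn_eq_sum_itinerary]
    simp [Real.negMulLog]
  rw [inv_mul_eq_div, eq_div_iff (by positivity)] at hH
  rw [← hH, Fintype.card_fin] at h
  refine le_of_mul_le_mul_left ?_ hc
  linarith

end OrbitMeasure

section LowerBound

variable {X : Type*} [MetricSpace X] [MeasurableSpace X] [BorelSpace X]

theorem measurePreserving_of_tendsto_orbitMeasure {f : X → X} (hf : Continuous f) {ι : Type*}
    {L : Filter ι} [L.NeBot] {μ : ι → ProbabilityMeasure X} {ν : ProbabilityMeasure X}
    (hν : Tendsto μ L (𝓝 ν)) {S : ι → Finset X} {n : ι → ℕ} (hn : Tendsto n L atTop)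
    (hμ : ∀ a, (μ a : Measure X) = orbitMeasure f (S a) (n a)) :
    MeasurePreserving f (ν : Measure X) (ν : Measure X) := by
  refine ⟨hf.measurable, ?_⟩
  have := Measure.isProbabilityMeasure_map (μ := (ν : Measure X)) hf.measurable.aemeasurable
  refine ext_of_forall_integral_eq_of_IsFiniteMeasure fun g => ?_
  rw [integral_map hf.measurable.aemeasurable g.continuous.aestronglyMeasurable]
  have h1 := (ProbabilityMeasure.tendsto_iff_forall_integral_tendsto.1 hν)
    (g.compContinuous ⟨f, hf⟩)
  have h2 := (ProbabilityMeasure.tendsto_iff_forall_integral_tendsto.1 hν) g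
  refine sub_eq_zero.1 (tendsto_nhds_unique (h1.sub h2) ?_)
  have hlim : Tendsto (fun a => 2 * ‖g‖ / (n a : ℝ)) L (𝓝 0) :=
    (tendsto_const_div_atTop_nhds_zero_nat (2 * ‖g‖)).comp hn
  refine squeeze_zero_norm (fun a => ?_) hlim
  simp only [hμ, integral_orbitMeasure, BoundedContinuousFunction.compContinuous_apply,
    ContinuousMap.coe_mk, ← mul_sub, ← Finset.sum_sub_distrib]
  have htel : ∀ x, ∑ i ∈ Finset.range (n a), (g (f (f^[i] x)) - g (f^[i] x)) =
      g (f^[n a] x) - g x := fun x => by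
    simpa only [Function.iterate_succ_apply', Function.iterate_zero, id] using
      Finset.sum_range_sub (fun i => g (f^[i] x)) (n a)
  simp only [htel]
  rw [norm_mul, norm_inv, norm_mul, Real.norm_natCast, Real.norm_natCast, inv_mul_eq_div]
  have hb : ‖∑ x ∈ S a, (g (f^[n a] x) - g x)‖ ≤ (S a).card * (2 * ‖g‖) := by
    rw [← nsmul_eq_mul, ← Finset.sum_const]
    refine norm_sum_le_of_le _ fun x _ => (norm_sub_le _ _).trans ?_
    linarith [g.norm_coe_le_norm (f^[n a] x), g.norm_coe_le_norm x]
  rcases (Nat.zero_le (S a).card).eq_or_lt with h0 | h0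
  · rw [← h0]; simp; positivity
  · have : (0 : ℝ) < (S a).card := by exact_mod_cast h0
    calc _ ≤ ((S a).card * (2 * ‖g‖)) / ((n a : ℝ) * (S a).card) := by gcongr
      _ = _ := by rw [mul_comm (n a : ℝ), mul_div_mul_left _ _ this.ne']

theorem tendsto_partHn {f : X → X} (hf : Continuous f) {ι : Type*} {L : Filter ι}
    {μ : ι → ProbabilityMeasure X} {ν : ProbabilityMeasure X} (hν : Tendsto μ L (𝓝 ν))
    (hinv : MeasurePreserving f (ν : Measure X) (ν : Measure X)) {k : ℕ} {P : X → Fin k}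
    {N : Set X} (hN : MeasurableSet N) (hνN : (ν : Measure X) N = 0)
    (hP : ∀ x ∉ N, ∀ᶠ y in 𝓝 x, P y = P x) (q : ℕ) :
    Tendsto (fun a => partHn f (μ a : Measure X) P q) L (𝓝 (partHn f (ν : Measure X) P q)) := by
  simp only [partHn_eq_sum_itinerary]
  refine tendsto_finsetSum _ fun c _ => (Real.continuous_negMulLog.tendsto _).comp ?_
  have hfr : frontier (itinerary f P q ⁻¹' {c}) ⊆ ⋃ i : Fin q, f^[i] ⁻¹' N := by
    intro x hx
    by_contra hxN
    simp only [mem_iUnion, mem_preimage, not_exists] at hxN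
    have hloc : ∀ᶠ y in 𝓝 x, itinerary f P q y = itinerary f P q x := by
      have : ∀ᶠ y in 𝓝 x, ∀ i : Fin q, P (f^[i] y) = P (f^[i] x) :=
        eventually_all.2 fun i => (hf.iterate i).continuousAt.eventually (hP _ (hxN i))
      filter_upwards [this] with y hy
      exact funext hy
    by_cases hxc : itinerary f P q x = c
    · refine hx.2 (mem_interior_iff_mem_nhds.2 ?_)
      filter_upwards [hloc] with y hy
      exact hy.trans hxc
    · obtain ⟨y, hy, hyc⟩ := (mem_closure_iff_frequently.1 hx.1).and_eventually hloc |>.exists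
      exact hxc (hyc.symm.trans hy)
  have hnull : (ν : Measure X) (frontier (itinerary f P q ⁻¹' {c})) = 0 :=
    measure_mono_null hfr (measure_iUnion_null fun i =>
      ((hinv.iterate i).measure_preimage hN.nullMeasurableSet).trans hνN)
  have h := ProbabilityMeasure.tendsto_measure_of_null_frontier_of_tendsto' hν hnull
  exact (ENNReal.tendsto_toReal (measure_ne_top _ _)).comp h

variable [CompactSpace X]

/-- A finite measurable partition into sets of small diameter which is locally constant off a
closed null set. -/
theorem exists_partition_null_frontier [Nonempty X] (ν : Measure X) [IsFiniteMeasure ν] {ε : ℝ}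
    (hε : 0 < ε) :
    ∃ (k : ℕ) (P : X → Fin k) (N : Set X), Measurable P ∧ MeasurableSet N ∧ ν N = 0 ∧
      (∀ x y, P x = P y → dist x y ≤ ε) ∧ ∀ x ∉ N, ∀ᶠ y in 𝓝 x, P y = P x := by
  classical
  have hr : ∀ x : X, ∃ r ∈ Ioo 0 (ε / 2), ν (frontier (Metric.thickening r {x})) = 0 := fun x =>
    exists_null_frontier_thickening ν {x} (half_pos hε)
  choose r hr hν using hr
  simp only [Metric.thickening_singleton] at hν
  obtain ⟨T, hT⟩ := isCompact_univ.elim_finite_subcover (fun x => Metric.ball x (r x))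
    (fun x => Metric.isOpen_ball)
    fun x _ => mem_iUnion.2 ⟨x, Metric.mem_ball_self (hr x).1⟩
  let e : Fin T.card ≃ T := T.equivFin.symm
  let B : Fin T.card → Set X := fun j => Metric.ball (e j : X) (r (e j))
  have hB : ∀ x, ∃ j, x ∈ B j := fun x => by
    obtain ⟨z, hz, hxz⟩ : ∃ z ∈ T, x ∈ Metric.ball z (r z) := by simpa using hT (mem_univ x)
    exact ⟨e.symm ⟨z, hz⟩, by simpa [B] using hxz⟩
  obtain ⟨j₀, -⟩ := hB (Classical.arbitrary X)
  let F : (Fin T.card → Bool) → Fin T.card := fun b =>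
    if h : ∃ j, b j = true then h.choose else j₀
  let I : X → Fin T.card → Bool := fun x j => decide (x ∈ B j)
  have hF : ∀ x, x ∈ B (F (I x)) := fun x => by
    have h : ∃ j, I x j = true := by simpa [I] using hB x
    have := h.choose_spec
    simp only [F, dif_pos h]
    simpa [I] using this
  refine ⟨T.card, fun x => F (I x), ⋃ j, frontier (B j), ?_, ?_, ?_, ?_, ?_⟩
  · refine (measurable_of_finite F).comp (measurable_pi_lambda _ fun j => ?_)
    exact measurable_to_bool (by
      have : (fun x => I x j) ⁻¹' {true} = B j := by ext; simp [I]
      rw [this]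
      exact Metric.isOpen_ball.measurableSet)
  · exact .iUnion fun j => isClosed_frontier.measurableSet
  · exact measure_iUnion_null fun j => hν _
  · intro x y hxy
    have h1 := hF x
    have h2 : y ∈ B (F (I x)) := (show F (I x) = F (I y) from hxy) ▸ hF y
    have h3 := (hr (e (F (I x)))).2
    have h4 := dist_triangle_right x y (e (F (I x)))
    rw [Metric.mem_ball] at h1 h2
    linarith
  · intro x hx
    simp only [mem_iUnion, not_exists] at hx
    have : ∀ᶠ y in 𝓝 x, ∀ j, (y ∈ B j ↔ x ∈ B j) := by
      rw [eventually_all]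
      intro j
      by_cases hxj : x ∈ B j
      · filter_upwards [Metric.isOpen_ball.mem_nhds hxj] with y hy
        exact iff_of_true hy hxj
      · have : x ∉ closure (B j) := fun h => hx j ⟨h, fun h' => hxj (interior_subset h')⟩
        filter_upwards [isClosed_closure.isOpen_compl.mem_nhds this] with y hy
        exact iff_of_false (fun h => hy (subset_closure h)) hxj
    filter_upwards [this] with y hy
    simp [I, hy]

/-- The lower half of the variational principle. -/
theorem exists_measurePreserving_le_ksEnt {f : X → X} (hf : Continuous f) {E : Set X} {ε : ℝ}
    (hε : 0 < ε) {c : ℝ} (hc : 0 ≤ c)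
    (h : (c : EReal) <
      limsup (fun n : ℕ => ((Real.log (sepCount f E n ε) / n : ℝ) : EReal)) atTop) :
    ∃ ν : ProbabilityMeasure X, MeasurePreserving f (ν : Measure X) (ν : Measure X) ∧
      (c : EReal) ≤ ksEnt f (ν : Measure X) := by
  have hfreq : ∃ᶠ n : ℕ in atTop, 0 < n ∧ ∃ S : Finset X, S.Nonempty ∧ IsDynSep f E n ε ↑S ∧
      c * n ≤ Real.log S.card := by
    refine ((frequently_lt_of_lt_limsup (by isBoundedDefault) h).and_eventually
      (eventually_gt_atTop 0)).mono fun n hn => ⟨hn.2, ?_⟩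
    have hn0 : (0 : ℝ) < n := by exact_mod_cast hn.2
    have h1 : c < Real.log (sepCount f E n ε) / n := EReal.coe_lt_coe_iff.1 hn.1
    rw [lt_div_iff₀ hn0] at h1
    have hne : {k | ∃ S : Finset X, IsDynSep f E n ε ↑S ∧ S.card = k}.Nonempty :=
      ⟨0, ∅, by simp [IsDynSep], rfl⟩
    obtain ⟨S, hS, hcard⟩ := Nat.sSup_mem hne (bddAbove_card_isDynSep hf E n hε)
    have hcard' : S.card = sepCount f E n ε := hcard
    rw [← hcard'] at h1
    refine ⟨S, ?_, hS, h1.le⟩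
    rw [Finset.nonempty_iff_ne_empty]
    rintro rfl
    have : 0 ≤ c * n := by positivity
    simp at h1
    linarith
  obtain ⟨φ, hφ, hφS⟩ := extraction_of_frequently_atTop hfreq
  choose hφ0 S hSne hSsep hSlog using hφS
  obtain ⟨x₀, -⟩ := hSne 0
  have : Nonempty X := ⟨x₀⟩
  let μ : ℕ → ProbabilityMeasure X := fun a =>
    ⟨orbitMeasure f (S a) (φ a), isProbabilityMeasure_orbitMeasure f (hSne a) (hφ0 a)⟩
  let U : Ultrafilter ℕ := hyperfilter ℕ
  have hU : (U : Filter ℕ) ≤ atTop := Nat.hyperfilter_le_atTop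
  obtain ⟨ν, -, hν⟩ := (isCompact_univ (X := ProbabilityMeasure X)).ultrafilter_le_nhds (U.map μ)
    (by simp)
  have hν : Tendsto μ U (𝓝 ν) := hν
  have hφU : Tendsto φ U atTop := hφ.tendsto_atTop.mono_left hU
  have hinv := measurePreserving_of_tendsto_orbitMeasure hf hν hφU (S := S) fun a => rfl
  refine ⟨ν, hinv, ?_⟩
  obtain ⟨k, P, N, hP, hN, hνN, hdiam, hloc⟩ :=
    exists_partition_null_frontier (ν : Measure X) hε
  refine le_iSup_of_le k (le_iSup₂_of_le P hP (EReal.coe_le_coe_iff.2 (le_ciInf fun q => ?_)))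
  have hq : (0 : ℝ) < q + 1 := by positivity
  rw [le_div_iff₀ hq]
  have hlim : Tendsto (fun a => 2 * ((q : ℝ) + 1) ^ 2 * Real.log k / (φ a : ℝ) +
      partHn f (μ a : Measure X) P (q + 1)) U (𝓝 (0 + partHn f (ν : Measure X) P (q + 1))) :=
    ((tendsto_const_div_atTop_nhds_zero_nat _).comp hφU).add
      (tendsto_partHn hf hν hinv hN hνN hloc (q + 1))
  rw [zero_add] at hlim
  refine ge_of_tendsto hlim ?_
  filter_upwards [hφU.eventually_ge_atTop (q + 1)] with a ha
  have hφa : (0 : ℝ) < φ a := by exact_mod_cast hφ0 a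
  have h1 := mul_log_card_le_partHn_orbitMeasure hf.measurable hP (hSne a) (Nat.succ_pos q) ha
    fun x hx y hy hxy => by
      obtain ⟨i, hi, hd⟩ := (hSsep a).2 x hx y hy hxy
      exact ⟨i, hi, fun hPi => hd.not_ge (hdiam _ _ hPi)⟩
  push_cast at h1
  have h2 := mul_le_mul_of_nonneg_left (hSlog a) hq.le
  rw [div_add' _ _ _ hφa.ne', le_div_iff₀ hφa]
  have h3 : (μ a : Measure X) = orbitMeasure f (S a) (φ a) := rfl
  rw [h3]
  linarith

end LowerBound

section Cocycle

variable {X : Type*} {m : ℕ} {f : X → X} {A : X → (Em m ≃L[ℝ] Em m)}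

theorem pow_mul_norm_le_norm_cocycle {κ : ℝ} (hκ0 : 0 ≤ κ) (hκ : ∀ x v, κ * ‖v‖ ≤ ‖A x v‖)
    (x : X) (n : ℕ) (v : Em m) : κ ^ n * ‖v‖ ≤ ‖cocycle f A x n v‖ := by
  induction n with
  | zero => simp [cocycle]
  | succ n ih =>
    calc κ ^ (n + 1) * ‖v‖ = κ * (κ ^ n * ‖v‖) := by ring
      _ ≤ κ * ‖cocycle f A x n v‖ := by gcongr
      _ ≤ _ := hκ _ _

theorem pow_le_norm_cocycle [Nontrivial (Em m)] {κ : ℝ} (hκ0 : 0 ≤ κ)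
    (hκ : ∀ x v, κ * ‖v‖ ≤ ‖A x v‖) (x : X) (n : ℕ) : κ ^ n ≤ ‖cocycle f A x n‖ := by
  obtain ⟨v, hv⟩ := exists_norm_eq (Em m) zero_le_one
  calc κ ^ n = κ ^ n * ‖v‖ := by rw [hv, mul_one]
    _ ≤ ‖cocycle f A x n v‖ := pow_mul_norm_le_norm_cocycle hκ0 hκ x n v
    _ ≤ ‖cocycle f A x n‖ := (cocycle f A x n).unit_le_opNorm v hv.le

variable [TopologicalSpace X]

theorem continuous_cocycle (hf : Continuous f)
    (hA : Continuous fun x => ((A x : Em m →L[ℝ] Em m))) (n : ℕ) :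
    Continuous fun x => cocycle f A x n := by
  induction n with
  | zero => exact continuous_const
  | succ n ih => exact (hA.comp (hf.iterate n)).clm_comp ih

theorem exists_pos_mul_norm_le [CompactSpace X]
    (hA : Continuous fun x => ((A x : Em m →L[ℝ] Em m))) :
    ∃ κ : ℝ, 0 < κ ∧ ∀ x v, κ * ‖v‖ ≤ ‖A x v‖ := by
  have hcpt : IsCompact ((univ : Set X) ×ˢ Metric.sphere (0 : Em m) 1) :=
    isCompact_univ.prod (isCompact_sphere _ _)
  have hcont : Continuous fun z : X × Em m => ‖A z.1 z.2‖ :=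
    ((hA.comp continuous_fst).clm_apply continuous_snd).norm
  obtain ⟨κ, hκ, h⟩ := hcpt.exists_forall_le' hcont.continuousOn (a := 0) fun z hz => by
    rw [norm_pos_iff, ne_eq, (A z.1).map_eq_zero_iff, ← norm_eq_zero]
    have : ‖z.2‖ = 1 := by simpa using hz
    simp [this]
  refine ⟨κ, hκ, fun x v => ?_⟩
  rcases eq_or_ne v 0 with rfl | hv
  · simp
  have hv' : 0 < ‖v‖ := norm_pos_iff.2 hv
  have := h (x, ‖v‖⁻¹ • v) ⟨mem_univ _, by simp [norm_smul, hv'.ne']⟩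
  simp only [map_smul, norm_smul, norm_inv, norm_norm] at this
  rwa [inv_mul_eq_div, le_div_iff₀ hv'] at this

end Cocycle

section Mixture

variable {X : Type*} [MeasurableSpace X]

/-- The convex combination `(1 - t) ν + t μ` of two measures. -/
noncomputable def mixture (t : ℝ) (ν μ : Measure X) : Measure X :=
  ENNReal.ofReal (1 - t) • ν + ENNReal.ofReal t • μ

variable {t : ℝ} {ν μ : Measure X}

theorem isProbabilityMeasure_mixture (ht0 : 0 ≤ t) (ht1 : t ≤ 1) [IsProbabilityMeasure ν]
    [IsProbabilityMeasure μ] : IsProbabilityMeasure (mixture t ν μ) := by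
  constructor
  simp [mixture, ← ENNReal.ofReal_add (sub_nonneg.2 ht1) ht0]

theorem measurePreserving_mixture {f : X → X} (hν : MeasurePreserving f ν ν)
    (hμ : MeasurePreserving f μ μ) :
    MeasurePreserving f (mixture t ν μ) (mixture t ν μ) := by
  refine ⟨hν.measurable, ?_⟩
  rw [mixture, Measure.map_add _ _ hν.measurable, Measure.map_smul, Measure.map_smul, hν.map_eq,
    hμ.map_eq]

theorem mixture_real (ht0 : 0 ≤ t) (ht1 : t ≤ 1) [IsFiniteMeasure ν] [IsFiniteMeasure μ]
    (s : Set X) : (mixture t ν μ).real s = (1 - t) * ν.real s + t * μ.real s := by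
  simp only [Measure.real, mixture, Measure.add_apply, Measure.smul_apply, smul_eq_mul]
  rw [ENNReal.toReal_add (by finiteness) (by finiteness), ENNReal.toReal_mul, ENNReal.toReal_mul,
    ENNReal.toReal_ofReal ht0, ENNReal.toReal_ofReal (sub_nonneg.2 ht1)]

theorem integral_mixture (ht0 : 0 ≤ t) (ht1 : t ≤ 1) {g : X → ℝ} (hν : Integrable g ν)
    (hμ : Integrable g μ) :
    ∫ x, g x ∂(mixture t ν μ) = (1 - t) * ∫ x, g x ∂ν + t * ∫ x, g x ∂μ := by
  rw [mixture, integral_add_measure (hν.smul_measure (by finiteness))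
    (hμ.smul_measure (by finiteness)), integral_smul_measure, integral_smul_measure,
    ENNReal.toReal_ofReal ht0, ENNReal.toReal_ofReal (sub_nonneg.2 ht1), smul_eq_mul, smul_eq_mul]

theorem mul_partHn_le_partHn_mixture (ht0 : 0 ≤ t) (ht1 : t ≤ 1) [IsProbabilityMeasure ν]
    [IsProbabilityMeasure μ] (f : X → X) {k : ℕ} (P : X → Fin k) (n : ℕ) :
    (1 - t) * partHn f ν P n ≤ partHn f (mixture t ν μ) P n := by
  simp only [partHn_eq_sum_itinerary, Finset.mul_sum, mixture_real ht0 ht1]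
  refine Finset.sum_le_sum fun c _ => ?_
  have h := Real.concaveOn_negMulLog.2 (x := ν.real (itinerary f P n ⁻¹' {c}))
    (y := μ.real (itinerary f P n ⁻¹' {c})) measureReal_nonneg measureReal_nonneg
    (sub_nonneg.2 ht1) ht0 (by ring)
  simp only [smul_eq_mul] at h
  have h' : 0 ≤ t * Real.negMulLog (μ.real (itinerary f P n ⁻¹' {c})) :=
    mul_nonneg ht0 (Real.negMulLog_nonneg measureReal_nonneg measureReal_le_one)
  linarith

theorem mul_iInf_partHn_le_ksEnt_mixture (ht0 : 0 ≤ t) (ht1 : t ≤ 1) [IsProbabilityMeasure ν]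
    [IsProbabilityMeasure μ] (f : X → X) {k : ℕ} {P : X → Fin k} (hP : Measurable P) :
    (((1 - t) * ⨅ n : ℕ, partHn f ν P (n + 1) / ((n : ℝ) + 1) : ℝ) : EReal) ≤
      ksEnt f (mixture t ν μ) := by
  refine le_iSup_of_le k (le_iSup₂_of_le P hP (EReal.coe_le_coe_iff.2 (le_ciInf fun n => ?_)))
  calc _ ≤ (1 - t) * (partHn f ν P (n + 1) / ((n : ℝ) + 1)) :=
        mul_le_mul_of_nonneg_left (ciInf_le (bddBelow_partHn_div f ν P) n) (sub_nonneg.2 ht1)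
    _ ≤ _ := by
        rw [mul_div_assoc']
        gcongr
        exact mul_partHn_le_partHn_mixture ht0 ht1 f P _

theorem ksEnt_nonneg (f : X → X) (μ : Measure X) [IsProbabilityMeasure μ] : 0 ≤ ksEnt f μ :=
  le_iSup_of_le 1 (le_iSup₂_of_le (fun _ => 0) measurable_const (EReal.coe_nonneg.2
    (Real.iInf_nonneg fun n => div_nonneg (partHn_nonneg μ _) (by positivity))))

end Mixture

section MaximalExponent

variable {X : Type*} [MetricSpace X] [CompactSpace X] [MeasurableSpace X] [BorelSpace X] {m : ℕ}
  [Nontrivial (Em m)] {f : X → X} {A : X → (Em m ≃L[ℝ] Em m)}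

theorem integrable_log_norm_cocycle (hf : Continuous f)
    (hA : Continuous fun x => ((A x : Em m →L[ℝ] Em m))) (μ : Measure X) [IsFiniteMeasure μ]
    (n : ℕ) : Integrable (fun x => Real.log ‖cocycle f A x n‖) μ := by
  obtain ⟨κ, hκ0, hκ⟩ := exists_pos_mul_norm_le hA
  have hcont : Continuous fun x => Real.log ‖cocycle f A x n‖ :=
    (continuous_cocycle hf hA n).norm.log fun x =>
      ((pow_pos hκ0 n).trans_le (pow_le_norm_cocycle hκ0.le hκ x n)).ne'
  exact hcont.integrable_of_hasCompactSupport (HasCompactSupport.of_compactSpace _)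

theorem exists_le_integral_log_norm_cocycle_div (hf : Continuous f)
    (hA : Continuous fun x => ((A x : Em m →L[ℝ] Em m))) :
    ∃ b : ℝ, ∀ (μ : Measure X) [IsProbabilityMeasure μ] (n : ℕ),
      b ≤ (∫ x, Real.log ‖cocycle f A x (n + 1)‖ ∂μ) / ((n : ℝ) + 1) := by
  obtain ⟨κ, hκ0, hκ⟩ := exists_pos_mul_norm_le hA
  refine ⟨Real.log κ, fun μ _ n => ?_⟩
  have h : ∀ x, ((n : ℝ) + 1) * Real.log κ ≤ Real.log ‖cocycle f A x (n + 1)‖ := fun x => by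
    have := Real.log_le_log (pow_pos hκ0 _) (pow_le_norm_cocycle (f := f) hκ0.le hκ x (n + 1))
    rw [Real.log_pow] at this
    exact_mod_cast this
  have hint := integral_mono (μ := μ) (integrable_const _)
    (integrable_log_norm_cocycle hf hA μ (n + 1)) h
  rw [le_div_iff₀ (by positivity), mul_comm]
  simpa using hint

theorem bddBelow_integral_log_norm_cocycle_div (hf : Continuous f)
    (hA : Continuous fun x => ((A x : Em m →L[ℝ] Em m))) (μ : Measure X)
    [IsProbabilityMeasure μ] :
    BddBelow (range fun n : ℕ =>
      (∫ x, Real.log ‖cocycle f A x (n + 1)‖ ∂μ) / ((n : ℝ) + 1)) := by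
  obtain ⟨b, hb⟩ := exists_le_integral_log_norm_cocycle_div hf hA
  exact ⟨b, by rintro _ ⟨n, rfl⟩; exact hb μ n⟩

theorem bddBelow_mle (hf : Continuous f)
    (hA : Continuous fun x => ((A x : Em m →L[ℝ] Em m))) :
    BddBelow {r : ℝ | ∃ ν : Measure X, IsProbabilityMeasure ν ∧
      MeasurePreserving f ν ν ∧ r = mle f A ν} := by
  obtain ⟨b, hb⟩ := exists_le_integral_log_norm_cocycle_div hf hA
  refine ⟨b, ?_⟩
  rintro _ ⟨ν, hν, -, rfl⟩
  exact le_ciInf fun n => hb ν n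

/-- The maximal Lyapunov exponent is a concave function of the measure. -/
theorem mle_mixture_ge (hf : Continuous f)
    (hA : Continuous fun x => ((A x : Em m →L[ℝ] Em m))) {t : ℝ} (ht0 : 0 ≤ t) (ht1 : t ≤ 1)
    (ν μ : Measure X) [IsProbabilityMeasure ν] [IsProbabilityMeasure μ] :
    (1 - t) * mle f A ν + t * mle f A μ ≤ mle f A (mixture t ν μ) := by
  refine le_ciInf fun n => ?_
  rw [integral_mixture ht0 ht1 (integrable_log_norm_cocycle hf hA ν _)
    (integrable_log_norm_cocycle hf hA μ _), add_div, mul_div_assoc, mul_div_assoc]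
  exact add_le_add
    (mul_le_mul_of_nonneg_left (ciInf_le (bddBelow_integral_log_norm_cocycle_div hf hA ν) n)
      (sub_nonneg.2 ht1))
    (mul_le_mul_of_nonneg_left (ciInf_le (bddBelow_integral_log_norm_cocycle_div hf hA μ) n) ht0)

end MaximalExponent

theorem mle_eq_zero_of_subsingleton {X : Type*} [MeasurableSpace X] {m : ℕ} [Subsingleton (Em m)]
    (f : X → X) (A : X → (Em m ≃L[ℝ] Em m)) (μ : Measure X) : mle f A μ = 0 := by
  have : ∀ x n, ‖cocycle f A x n‖ = 0 := fun x n => by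
    rw [Subsingleton.elim (cocycle f A x n) 0, norm_zero]
  simp [mle, this]

/-- **Proposition 2.13 (2), second part.** Let `f` be a homeomorphism of a compact metric space
with the entropy-dense property and `A : X → GL(m,ℝ)` a continuous matrix function such that
`μ ↦ χ_max(A,μ)` is lower semi-continuous on the invariant measures (weak* topology). If two
ergodic invariant measures have different maximal Lyapunov exponents w.r.t. `A`, then
`sup {h_μ(f) : μ ergodic, χ_max(A,μ) > inf_ν χ_max(A,ν)} = h_top(f)`. -/
theorem sup_entropy_not_minimizing_eq_htop
    {X : Type*} [MetricSpace X] [CompactSpace X] [MeasurableSpace X] [BorelSpace X] {m : ℕ}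
    (f : X ≃ₜ X) (hdense : EntropyDense (⇑f))
    (A : X → (Em m ≃L[ℝ] Em m))
    (hA : Continuous fun x => ((A x : Em m →L[ℝ] Em m)))
    (hlsc : LowerSemicontinuousOn (fun μ : ProbabilityMeasure X => mle (⇑f) A (μ : Measure X))
      {μ : ProbabilityMeasure X | MeasurePreserving (⇑f) (μ : Measure X) (μ : Measure X)})
    (hdiff : ∃ μ ν : Measure X, IsProbabilityMeasure μ ∧ IsProbabilityMeasure ν ∧
      Ergodic (⇑f) μ ∧ Ergodic (⇑f) ν ∧ mle (⇑f) A μ ≠ mle (⇑f) A ν) :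
    sSup {h : EReal | ∃ μ : Measure X, IsProbabilityMeasure μ ∧ Ergodic (⇑f) μ ∧
        sInf {r : ℝ | ∃ ν : Measure X, IsProbabilityMeasure ν ∧
          MeasurePreserving (⇑f) ν ν ∧ r = mle (⇑f) A ν} < mle (⇑f) A μ ∧
        h = ksEnt (⇑f) μ} = topEnt (⇑f) univ := by
  have hf : Continuous (⇑f) := f.continuous
  obtain ⟨μ₁, μ₂, hμ₁, hμ₂, he₁, he₂, hne⟩ := hdiff
  obtain _ | _ := subsingleton_or_nontrivial (Em m)
  · exact absurd (by simp [mle_eq_zero_of_subsingleton]) hne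
  set I : ℝ := sInf {r : ℝ | ∃ ν : Measure X, IsProbabilityMeasure ν ∧
    MeasurePreserving (⇑f) ν ν ∧ r = mle (⇑f) A ν}
  have hI : ∀ ν : Measure X, IsProbabilityMeasure ν → MeasurePreserving (⇑f) ν ν →
      I ≤ mle (⇑f) A ν := fun ν hν hinv => csInf_le (bddBelow_mle hf hA) ⟨ν, hν, hinv, rfl⟩
  obtain ⟨μ₀, hμ₀, hinv₀, hI₀⟩ : ∃ μ₀ : Measure X, IsProbabilityMeasure μ₀ ∧
      MeasurePreserving (⇑f) μ₀ μ₀ ∧ I < mle (⇑f) A μ₀ := by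
    have h₁ := hI μ₁ hμ₁ he₁.toMeasurePreserving
    have h₂ := hI μ₂ hμ₂ he₂.toMeasurePreserving
    rcases hne.lt_or_gt with h | h
    · exact ⟨μ₂, hμ₂, he₂.toMeasurePreserving, h₁.trans_lt h⟩
    · exact ⟨μ₁, hμ₁, he₁.toMeasurePreserving, h₂.trans_lt h⟩
  refine le_antisymm (sSup_le ?_) (le_of_forall_lt fun c hc => ?_)
  · rintro _ ⟨μ, hμ, he, -, rfl⟩
    exact ksEnt_le_topEnt hf he.toMeasurePreserving
  obtain ⟨r, hcr, hr⟩ := EReal.lt_iff_exists_real_btwn.1 hc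
  obtain ⟨ν, hν, hinv, hent⟩ : ∃ ν : Measure X, IsProbabilityMeasure ν ∧
      MeasurePreserving (⇑f) ν ν ∧ (r : EReal) < ksEnt (⇑f) ν := by
    rcases lt_or_ge r 0 with hr0 | hr0
    · exact ⟨μ₀, hμ₀, hinv₀, (EReal.coe_neg'.2 hr0).trans_le (ksEnt_nonneg _ _)⟩
    · simp only [topEnt, compactEnt, lt_iSup_iff] at hr
      obtain ⟨E, -, -, ε, hε, hlim⟩ := hr
      obtain ⟨r', hrr', hr'⟩ := EReal.lt_iff_exists_real_btwn.1 hlim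
      obtain ⟨ν, hinv, hν⟩ := exists_measurePreserving_le_ksEnt hf hε
        (hr0.trans (EReal.coe_lt_coe_iff.1 hrr').le) hr'
      exact ⟨ν, inferInstance, hinv, hrr'.trans_le hν⟩
  simp only [ksEnt, lt_iSup_iff] at hent
  obtain ⟨k, P, hP, ha⟩ := hent
  set a : ℝ := ⨅ n : ℕ, partHn (⇑f) ν P (n + 1) / ((n : ℝ) + 1)
  have ha' : r < a := EReal.coe_lt_coe_iff.1 ha
  obtain ⟨t, ht0, ht1, hta⟩ : ∃ t : ℝ, 0 < t ∧ t < 1 ∧ r < (1 - t) * a := by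
    have hlim : Tendsto (fun t : ℝ => (1 - t) * a) (𝓝[>] 0) (𝓝 ((1 - 0) * a)) :=
      Tendsto.mono_left (Continuous.tendsto (by fun_prop) 0) nhdsWithin_le_nhds
    have hev : ∀ᶠ t : ℝ in 𝓝[>] 0, r < (1 - t) * a := hlim.eventually_const_lt (by simpa using ha')
    obtain ⟨t, h1, h2⟩ := (hev.and (Ioo_mem_nhdsGT one_pos)).exists
    exact ⟨t, h2.1, h2.2, h1⟩
  let ρ : ProbabilityMeasure X := ⟨mixture t ν μ₀, isProbabilityMeasure_mixture ht0.le ht1.le⟩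
  have hρinv : MeasurePreserving (⇑f) (ρ : Measure X) (ρ : Measure X) :=
    measurePreserving_mixture hinv hinv₀
  have hρI : I < mle (⇑f) A (ρ : Measure X) := by
    refine lt_of_lt_of_le ?_ (mle_mixture_ge hf hA ht0.le ht1.le ν μ₀)
    nlinarith [hI ν hν hinv]
  have hρent : (r : EReal) < ksEnt (⇑f) (ρ : Measure X) :=
    (EReal.coe_lt_coe_iff.2 hta).trans_le
      (mul_iInf_partHn_le_ksEnt_mixture ht0.le ht1.le (⇑f) hP)
  obtain ⟨μ, hμG, hμe, hμent⟩ := hdense ρ hρinv _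
    (eventually_nhdsWithin_iff.1 (hlsc ρ hρinv I hρI)) r hρent
  refine (hcr.trans hμent).trans_le (le_sSup ⟨μ, inferInstance, hμe, ?_, rfl⟩)
  exact hμG hμe.toMeasurePreserving
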